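/- arXiv:1208.1044 — 4 statements merged into one kernel-verified Lean document; each statement's English description precedes it below -/
import Mathlib

section
/- Let K be a number field with ring of integers R = 𝒪_K and let g ∈ R be nonzero. Then there exists a positive real constant C_g such that for every nonzero a ∈ R and every f ∈ R[1/a] (the subring of K generated by R and 1/a) there exists h ∈ R[1/a] with f − g·h ∈ R and ‖f − g·h‖ < C_g. -/
open NumberField

/-- The subring `R[1/a]` of `K` generated by the ring of integers `R = 𝒪_K` and `1/a`. -/
noncomputable def ringOfIntegersLoc (K : Type*) [Field K] [NumberField K] (a : 𝓞 K) :
    Subring K :=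
  Subring.closure (((algebraMap (𝓞 K) K).range : Set K) ∪ {(a : K)⁻¹})

/-- Modulo `g`, every element of `R[1/a]` is represented by an element of `R`. -/
theorem exists_add_mul_of_mem_ringOfIntegersLoc (K : Type*) [Field K] [NumberField K]
    {g : 𝓞 K} (hg : g ≠ 0) {a : 𝓞 K} (ha : a ≠ 0) {f : K} (hf : f ∈ ringOfIntegersLoc K a) :
    ∃ r : 𝓞 K, ∃ h ∈ ringOfIntegersLoc K a, f = r + g * h := by
  have hR (r : 𝓞 K) : (r : K) ∈ ringOfIntegersLoc K a :=
    Subring.subset_closure (Or.inl ⟨r, rfl⟩)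
  have hinv : (a : K)⁻¹ ∈ ringOfIntegersLoc K a := Subring.subset_closure (Or.inr rfl)
  unfold ringOfIntegersLoc at hf
  induction hf using Subring.closure_induction with
  | mem x hx =>
    rcases hx with ⟨r, rfl⟩ | rfl
    · exact ⟨r, 0, zero_mem _, by simp⟩
    · have : Finite (𝓞 K ⧸ Ideal.span {g}) :=
        Ideal.finiteQuotientOfFreeOfNeBot _ (by simpa using hg)
      obtain ⟨i, j, hij, heq⟩ := Finite.exists_ne_map_eq_of_infinite
        (fun n : ℕ => Ideal.Quotient.mk (Ideal.span {g}) (a ^ n))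
      wlog hlt : i < j generalizing i j
      · exact this j i hij.symm heq.symm (by omega)
      obtain ⟨m, rfl⟩ := Nat.exists_eq_add_of_lt hlt
      obtain ⟨t, ht⟩ := Ideal.mem_span_singleton.mp (Ideal.Quotient.eq.mp heq)
      have ht' : (a : K) ^ i - (a : K) ^ (i + m + 1) = g * t := by
        exact_mod_cast congrArg (algebraMap (𝓞 K) K) ht
      have ha' : (a : K) ≠ 0 := by simpa using ha
      refine ⟨a ^ m, t * (a : K)⁻¹ ^ (i + 1), mul_mem (hR t) (pow_mem hinv _), ?_⟩
      rw [← mul_assoc, ← ht', inv_pow]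
      push_cast
      field_simp
      ring
  | zero => exact ⟨0, 0, zero_mem _, by simp⟩
  | one => exact ⟨1, 0, zero_mem _, by simp⟩
  | add x y _ _ hx hy =>
    obtain ⟨r, h, hh, rfl⟩ := hx
    obtain ⟨s, k, hk, rfl⟩ := hy
    exact ⟨r + s, h + k, add_mem hh hk, by push_cast; ring⟩
  | neg x _ hx =>
    obtain ⟨r, h, hh, rfl⟩ := hx
    exact ⟨-r, -h, neg_mem hh, by push_cast; ring⟩
  | mul x y _ _ hx hy =>
    obtain ⟨r, h, hh, rfl⟩ := hx
    obtain ⟨s, k, hk, rfl⟩ := hy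
    exact ⟨r * s, r * k + s * h + g * (h * k),
      add_mem (add_mem (mul_mem (hR r) hk) (mul_mem (hR s) hh)) (mul_mem (hR g) (mul_mem hh hk)),
      by push_cast; ring⟩

/-- Lemma 2.7 of Fehm–Paran: for every nonzero `g ∈ R = 𝒪_K` there is a
constant `C_g > 0` such that for every nonzero `a ∈ R` and every `f ∈ R[1/a]` there is
`h ∈ R[1/a]` with `f - g·h ∈ R` and `‖f - g·h‖ < C_g`, where `‖·‖` is the house. -/
theorem stmt_1 (K : Type*) [Field K] [NumberField K]
    (g : 𝓞 K) (hg : g ≠ 0) :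
    ∃ C : ℝ, 0 < C ∧ ∀ a : 𝓞 K, a ≠ 0 → ∀ f ∈ ringOfIntegersLoc K a,
      ∃ h ∈ ringOfIntegersLoc K a,
        f - (g : K) * h ∈ (algebraMap (𝓞 K) K).range ∧ house (f - (g : K) * h) < C := by
  have : Finite (𝓞 K ⧸ Ideal.span {g}) :=
    Ideal.finiteQuotientOfFreeOfNeBot _ (by simpa using hg)
  obtain ⟨C, hC⟩ := (Set.finite_range
    (fun q : 𝓞 K ⧸ Ideal.span {g} => house ((Quotient.out q : 𝓞 K) : K))).bddAbove
  refine ⟨|C| + 1, by positivity, fun a ha f hf => ?_⟩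
  obtain ⟨r, h, hh, rfl⟩ := exists_add_mul_of_mem_ringOfIntegersLoc K hg ha hf
  let q := Ideal.Quotient.mk (Ideal.span {g}) r
  have hq : Ideal.Quotient.mk (Ideal.span {g}) r = Ideal.Quotient.mk _ (Quotient.out q) :=
    (Quotient.out_eq q).symm
  obtain ⟨s, hs⟩ := Ideal.mem_span_singleton.mp (Ideal.Quotient.eq.mp hq)
  have hs' : (r : K) - (Quotient.out q : 𝓞 K) = g * s := by
    exact_mod_cast congrArg (algebraMap (𝓞 K) K) hs
  have key : (r : K) + g * h - g * (h + s) = (Quotient.out q : 𝓞 K) := by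
    linear_combination hs'
  refine ⟨h + s, add_mem hh (Subring.subset_closure (Or.inl ⟨s, rfl⟩)), ?_⟩
  rw [key]
  exact ⟨⟨_, rfl⟩, lt_of_le_of_lt ((hC ⟨q, rfl⟩).trans (le_abs_self C)) (lt_add_one _)⟩
end

section
/- Let A be an integral domain equipped with an ultrametric absolute value |·| (so |xy| = |x|·|y|, |x+y| ≤ max(|x|,|y|), and |x| = 0 iff x = 0), and let A_0 be a subring of A that is dense in A for the metric induced by |·| and satisfies A = A_0 + gA for every nonzero g ∈ A_0. Put E = Quot(A), E_0 = Quot(A_0), and let E_1, E_2 be subfields of E with E_0 ⊆ E_2. Fix n ∈ ℕ and extend |·| to n×n matrices entrywise by taking the maximum over the entries. Assume: (i) every element of E can be written as x/s with x ∈ A and s ∈ A_0 ∖ {0}; (ii) every b ∈ Mat_n(A) with |b − 𝟙| < 1 (𝟙 the identity matrix) factors as b = b_1·b_2 with b_1 ∈ GL_n(E_1) and b_2 ∈ GL_n(E_2). Then GL_n(E) = GL_n(E_1)·GL_n(E_2), i.e. every invertible n×n matrix over E is a product of an invertible matrix over E_1 and an invertible matrix over E_2. -/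
/-- A matrix with entries in a subfield `S` which is invertible over `S`, i.e. an element
of `GL_n(S)`: all entries lie in `S` and the determinant is nonzero. -/
def MemGL {E : Type*} [Field E] {n : ℕ} (S : Subfield E) (M : Matrix (Fin n) (Fin n) E) :
    Prop :=
  (∀ i j, M i j ∈ S) ∧ M.det ≠ 0

namespace MemGL

variable {E : Type*} [Field E] {n : ℕ} {S : Subfield E} {M N : Matrix (Fin n) (Fin n) E}

theorem mul (hM : MemGL S M) (hN : MemGL S N) : MemGL S (M * N) := by
  refine ⟨fun i j => ?_, ?_⟩
  · rw [Matrix.mul_apply]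
    exact sum_mem fun k _ => mul_mem (hM.1 i k) (hN.1 k j)
  · rw [Matrix.det_mul]
    exact mul_ne_zero hM.2 hN.2

theorem inv (hM : MemGL S M) : MemGL S M⁻¹ := by
  obtain ⟨M', rfl⟩ : ∃ M' : Matrix (Fin n) (Fin n) S, M = S.subtype.mapMatrix M' :=
    ⟨fun i j => ⟨M i j, hM.1 i j⟩, rfl⟩
  refine ⟨fun i j => ?_, ?_⟩
  · rw [Matrix.inv_def, ← RingHom.map_adjugate, ← RingHom.map_det, Ring.inverse_eq_inv',
      Matrix.smul_apply, smul_eq_mul]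
    exact mul_mem (inv_mem (SetLike.coe_mem _)) (SetLike.coe_mem _)
  · exact (Matrix.isUnit_nonsing_inv_det _ (isUnit_iff_ne_zero.mpr hM.2)).ne_zero

theorem smul (hM : MemGL S M) {c : E} (hc : c ∈ S) (hc0 : c ≠ 0) : MemGL S (c • M) := by
  refine ⟨fun i j => mul_mem hc (hM.1 i j), ?_⟩
  rw [Matrix.det_smul]
  exact mul_ne_zero (pow_ne_zero _ hc0) hM.2

end MemGL

/-- If every fraction has a denominator in `A₀`, every nonzero element of `A` divides a nonzero
element of `A₀`. -/
theorem exists_mul_mem_of_fraction_denominators {A : Type*} [CommRing A] [IsDomain A]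
    {A₀ : Subring A}
    (hi : ∀ e : FractionRing A, ∃ x : A, ∃ s ∈ A₀, s ≠ 0 ∧
      e * algebraMap A (FractionRing A) s = algebraMap A (FractionRing A) x)
    {t : A} (ht : t ≠ 0) : ∃ y : A, t * y ∈ A₀ ∧ t * y ≠ 0 := by
  obtain ⟨y, s, hs, hs0, h⟩ := hi (algebraMap A (FractionRing A) t)⁻¹
  have ht' : algebraMap A (FractionRing A) t ≠ 0 := by simpa using ht
  have hts : t * y = s := by
    apply IsFractionRing.injective A (FractionRing A)
    rw [map_mul, ← h, mul_inv_cancel_left₀ ht']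
  exact ⟨y, hts ▸ hs, hts ▸ hs0⟩

/-- If every fraction has a denominator in `A₀`, every matrix of fractions has a common
denominator in `A₀`. -/
theorem exists_common_denominator_matrix {A : Type*} [CommRing A] [IsDomain A]
    {A₀ : Subring A}
    (hi : ∀ e : FractionRing A, ∃ x : A, ∃ s ∈ A₀, s ≠ 0 ∧
      e * algebraMap A (FractionRing A) s = algebraMap A (FractionRing A) x)
    {n : ℕ} (M : Matrix (Fin n) (Fin n) (FractionRing A)) :
    ∃ s ∈ A₀, s ≠ 0 ∧ ∃ X : Matrix (Fin n) (Fin n) A,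
      algebraMap A (FractionRing A) s • M = X.map (algebraMap A (FractionRing A)) := by
  obtain ⟨t, ht⟩ := IsLocalization.exist_integer_multiples_of_finite (nonZeroDivisors A)
    (fun p : Fin n × Fin n => M p.1 p.2)
  choose X hX using ht
  obtain ⟨y, hy, hy0⟩ :=
    exists_mul_mem_of_fraction_denominators hi (nonZeroDivisors.coe_ne_zero t)
  refine ⟨_, hy, hy0, Matrix.of fun i j => y * X (i, j), ?_⟩
  ext i j
  have h := hX (i, j)
  rw [Algebra.smul_def] at h
  simp only [Matrix.smul_apply, Matrix.map_apply, Matrix.of_apply, smul_eq_mul, map_mul, h]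
  ring

/-- Multiplication by a fixed matrix is continuous at zero for an entrywise absolute value. -/
theorem exists_pos_forall_abv_matrix_mul_lt_one {A : Type*} [CommRing A]
    (v : AbsoluteValue A ℝ) {n : ℕ} (X : Matrix (Fin n) (Fin n) A) :
    ∃ ε : ℝ, 0 < ε ∧ ∀ F : Matrix (Fin n) (Fin n) A, (∀ i j, v (F i j) < ε) →
      ∀ i j, v ((X * F) i j) < 1 := by
  set C : ℝ := ∑ i, ∑ k, v (X i k) with hC
  have hrow : ∀ i, 0 ≤ ∑ k, v (X i k) := fun i => Finset.sum_nonneg fun k _ => v.nonneg _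
  have hC0 : 0 ≤ C := Finset.sum_nonneg fun i _ => hrow i
  refine ⟨1 / (1 + C), by positivity, fun F hF i j => ?_⟩
  calc v ((X * F) i j) ≤ ∑ k, v (X i k * F k j) := by
        rw [Matrix.mul_apply]
        exact v.sum_le _ _
    _ ≤ ∑ k, v (X i k) * (1 / (1 + C)) := by
        refine Finset.sum_le_sum fun k _ => ?_
        rw [map_mul]
        exact mul_le_mul_of_nonneg_left (hF k j).le (v.nonneg _)
    _ = (∑ k, v (X i k)) * (1 / (1 + C)) := by rw [Finset.sum_mul]
    _ ≤ C * (1 / (1 + C)) := by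
        refine mul_le_mul_of_nonneg_right ?_ (by positivity)
        exact Finset.single_le_sum (f := fun i => ∑ k, v (X i k)) (fun i _ => hrow i)
          (Finset.mem_univ i)
    _ < 1 := by
        rw [mul_one_div, div_lt_one (by positivity)]
        linarith

/-- If `A₀` is dense in `A` and `A = A₀ + gA`, then `A₀` approximates each element of `A` modulo
an arbitrarily small multiple of `g`. -/
theorem exists_approx_mod {A : Type*} [CommRing A] (v : AbsoluteValue A ℝ) {A₀ : Subring A}
    (hdense : ∀ x : A, ∀ ε : ℝ, 0 < ε → ∃ y ∈ A₀, v (x - y) < ε)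
    {g : A} (hg : g ∈ A₀) (hdiv : ∀ x : A, ∃ y ∈ A₀, ∃ z : A, x = y + g * z)
    (x : A) {ε : ℝ} (hε : 0 < ε) :
    ∃ y ∈ A₀, ∃ z : A, v z < ε ∧ x = y + g * z := by
  obtain ⟨y, hy, z, rfl⟩ := hdiv x
  obtain ⟨w, hw, hzw⟩ := hdense z ε hε
  exact ⟨y + g * w, add_mem hy (mul_mem hg hw), z - w, hzw, by ring⟩

/-- Proposition 3.2 of Fehm–Paran: let `A` be a domain with an
ultrametric absolute value `v`, `A₀ ⊆ A` a dense subring with `A = A₀ + gA` for every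
nonzero `g ∈ A₀`, `E = Quot(A)`, `E₀ = Quot(A₀)`, and `E₁, E₂ ⊆ E` subfields with
`E₀ ⊆ E₂`. If (i) every element of `E` is of the form `x/s` with `x ∈ A`, `0 ≠ s ∈ A₀`,
and (ii) every `b ∈ Mat_n(A)` with `|b - 1| < 1` factors as `b = b₁b₂` with
`b₁ ∈ GL_n(E₁)`, `b₂ ∈ GL_n(E₂)`, then `GL_n(E) = GL_n(E₁)·GL_n(E₂)`. -/
theorem stmt_10 (A : Type*) [CommRing A] [IsDomain A]
    (v : AbsoluteValue A ℝ) (hv : IsNonarchimedean v)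
    (A₀ : Subring A)
    (hdense : ∀ x : A, ∀ ε : ℝ, 0 < ε → ∃ y ∈ A₀, v (x - y) < ε)
    (hdiv : ∀ g ∈ A₀, g ≠ 0 → ∀ x : A, ∃ y ∈ A₀, ∃ z : A, x = y + g * z)
    (E₁ E₂ : Subfield (FractionRing A))
    (hE₀ : Subfield.closure ((algebraMap A (FractionRing A)) '' A₀) ≤ E₂)
    (n : ℕ)
    (hi : ∀ e : FractionRing A, ∃ x : A, ∃ s ∈ A₀, s ≠ 0 ∧
      e * algebraMap A (FractionRing A) s = algebraMap A (FractionRing A) x)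
    (hii : ∀ b : Matrix (Fin n) (Fin n) A, (∀ i j, v ((b - 1) i j) < 1) →
      ∃ b₁ b₂ : Matrix (Fin n) (Fin n) (FractionRing A), MemGL E₁ b₁ ∧ MemGL E₂ b₂ ∧
        b.map (algebraMap A (FractionRing A)) = b₁ * b₂) :
    ∀ M : Matrix (Fin n) (Fin n) (FractionRing A), M.det ≠ 0 →
      ∃ M₁ M₂ : Matrix (Fin n) (Fin n) (FractionRing A),
        MemGL E₁ M₁ ∧ MemGL E₂ M₂ ∧ M = M₁ * M₂ := by
  intro M hM
  have hmem : ∀ a ∈ A₀, algebraMap A (FractionRing A) a ∈ E₂ := fun a ha =>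
    hE₀ (Subfield.subset_closure ⟨a, ha, rfl⟩)
  have hne : ∀ a : A, a ≠ 0 → algebraMap A (FractionRing A) a ≠ 0 := fun a ha => by
    simpa using ha
  obtain ⟨s, hs, hs0, X, hX⟩ := exists_common_denominator_matrix hi M
  have hXdet : X.det ≠ 0 := by
    intro h
    have h' := congrArg Matrix.det hX
    rw [Matrix.det_smul, ← RingHom.mapMatrix_apply, ← RingHom.map_det, h, map_zero] at h'
    exact mul_ne_zero (pow_ne_zero _ (hne s hs0)) hM h'
  obtain ⟨y, hg, hg0⟩ := exists_mul_mem_of_fraction_denominators hi hXdet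
  set g := X.det * y with hgdef
  obtain ⟨ε, hε, hsmall⟩ := exists_pos_forall_abv_matrix_mul_lt_one v X
  choose c hc F hF hcF using fun i j =>
    exists_approx_mod v hdense hg (hdiv g hg hg0) ((y • X.adjugate) i j) hε
  have hadj : y • X.adjugate = Matrix.of c + g • Matrix.of F := by
    ext i j
    exact hcF i j
  have hXc : X * Matrix.of c = g • (1 - X * Matrix.of F) := by
    rw [eq_sub_of_add_eq hadj.symm, mul_sub, Matrix.mul_smul, Matrix.mul_smul,
      Matrix.mul_adjugate, smul_smul, mul_comm y, ← hgdef, smul_sub]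
  obtain ⟨b₁, b₂, hb₁, hb₂, hb⟩ := hii (1 - X * Matrix.of F) fun i j => by
    rw [sub_sub_cancel_left, Matrix.neg_apply, v.map_neg]
    exact hsmall _ hF i j
  set φ := algebraMap A (FractionRing A) with hφ
  set C := (Matrix.of c).map φ with hCdef
  have hMC : φ s • (M * C) = φ g • (b₁ * b₂) := by
    rw [← hb, ← Matrix.smul_mul, hX, hCdef, ← Matrix.map_mul, hXc]
    ext i j
    simp
  have hCdet : C.det ≠ 0 := by
    intro h
    have h' := congrArg Matrix.det hMC
    rw [Matrix.det_smul, Matrix.det_smul, Matrix.det_mul, Matrix.det_mul, h, mul_zero,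
      mul_zero] at h'
    exact mul_ne_zero (pow_ne_zero _ (hne g hg0)) (mul_ne_zero hb₁.2 hb₂.2) h'.symm
  have hC : MemGL E₂ C := ⟨fun i j => hmem _ (hc i j), hCdet⟩
  refine ⟨b₁, ((φ s)⁻¹ * φ g) • (b₂ * C⁻¹), hb₁,
    (hb₂.mul hC.inv).smul (mul_mem (inv_mem (hmem s hs)) (hmem g hg))
      (mul_ne_zero (inv_ne_zero (hne s hs0)) (hne g hg0)), ?_⟩
  rw [Matrix.mul_smul, ← mul_assoc, mul_smul, ← Matrix.smul_mul (φ g), ← hMC, Matrix.smul_mul,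
    smul_smul, inv_mul_cancel₀ (hne s hs0), one_smul,
    Matrix.mul_nonsing_inv_cancel_right _ _ (isUnit_iff_ne_zero.mpr hCdet)]
end

section
/- Let K be a number field with ring of integers R = 𝒪_K, and let a ∈ R be nonzero and non-invertible in R. Then there exists a nonzero element b of ℤ[1/a] (the subring of K generated by 1/a) with ‖b‖ < 1. -/
open NumberField

/-- A subalgebra of a number field with no nonzero elements of house less than `1` embeds as a
discrete subgroup of a finite-dimensional real vector space, hence consists of integral elements. -/
theorem isIntegral_of_forall_one_le_house {K : Type*} [Field K] [NumberField K]
    (S : Subalgebra ℤ K) (hS : ∀ b ∈ S, b ≠ 0 → 1 ≤ house b) {x : K} (hx : x ∈ S) :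
    IsIntegral ℤ x := by
  let f : K →ₗ[ℤ] ((K →+* ℂ) → ℂ) := (canonicalEmbedding K).toIntAlgHom.toLinearMap
  have hf : Function.Injective f := canonicalEmbedding_injective K
  let L := S.toSubmodule.map f
  have : DiscreteTopology L := by
    rw [discreteTopology_iff_isOpen_singleton_zero, Metric.isOpen_singleton_iff]
    refine ⟨1, one_pos, ?_⟩
    rintro ⟨_, b, hb, rfl⟩ hlt
    have hlt' : ‖f b‖ < 1 := by simpa [dist_eq_norm] using hlt
    have hb0 : b = 0 := by
      by_contra hne
      exact (hS b hb hne).not_gt hlt'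
    ext1
    simp [hb0]
  have hfg : L.FG := Module.Finite.iff_fg.mp inferInstance
  exact IsIntegral.of_mem_of_fg S (Submodule.fg_of_fg_map_injective f hf hfg) x hx

/-- Lemma 4.2 of Fehm–Paran: if `a` is a nonzero non-invertible element
of the ring of integers `R = 𝒪_K` of a number field `K`, then the subring `ℤ[1/a]` of `K`
generated by `1/a` contains a nonzero element `b` with `‖b‖ < 1`, where
`‖x‖ = max_{σ : K →+* ℂ} |σ x|` is the house of `x`. -/
theorem stmt_14 (K : Type*) [Field K] [NumberField K]
    (a : 𝓞 K) (ha : a ≠ 0) (hunit : ¬IsUnit a) :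
    ∃ b ∈ Subring.closure {((a : K))⁻¹}, b ≠ 0 ∧ house b < 1 := by
  by_contra! h
  have hint : IsIntegral ℤ ((a : K))⁻¹ := by
    refine isIntegral_of_forall_one_le_house (subalgebraOfSubring (Subring.closure {((a : K))⁻¹}))
      h ?_
    exact Subring.subset_closure rfl
  have ha' : (a : K) ≠ 0 := by simpa using ha
  refine hunit (IsUnit.of_mul_eq_one (⟨_, hint⟩ : 𝓞 K) ?_)
  ext
  exact mul_inv_cancel₀ ha'
end

section
/- Let K/K_0 be a finite Galois extension of number fields, let R = 𝒪_K be the ring of integers of K, and let b ∈ R be nonzero. Then there exists z ∈ R, nonzero and non-invertible in R, such that z is a primitive element of K/K_0 (i.e. K = K_0(z)), the conjugates σ(z) for σ ∈ Gal(K/K_0) are pairwise coprime in R (σ(z)·R + τ(z)·R = R for all σ ≠ τ), and each conjugate σ(z) is coprime to b (σ(z)·R + b·R = R). -/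
open NumberField

/-- A nonzero element of the ring of integers divides a nonzero rational integer. -/
lemma exists_natCast_dvd {K : Type*} [Field K] [NumberField K] {e : 𝓞 K} (he : e ≠ 0) :
    ∃ d : ℕ, d ≠ 0 ∧ e ∣ (d : 𝓞 K) := by
  refine ⟨Ideal.absNorm (Ideal.span {e}), ?_, Ideal.mem_span_singleton.mp (Ideal.absNorm_mem _)⟩
  rw [Ne, Ideal.absNorm_eq_zero_iff, Ideal.span_singleton_eq_bot]
  exact he

/-- An algebraic integer all of whose complex conjugates have absolute value greater than `1`
is not a unit. -/
lemma not_isUnit_of_one_lt_norm_embeddings {K : Type*} [Field K] [NumberField K] {z : 𝓞 K}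
    (hz : ∀ φ : K →+* ℂ, 1 < ‖φ z‖) : ¬IsUnit z := by
  rintro ⟨u, rfl⟩
  obtain ⟨w⟩ : Nonempty (K →+* ℂ) := inferInstance
  have h1 : |Algebra.norm ℚ ((u : 𝓞 K) : K)| = 1 :=
    NumberField.isUnit_iff_norm.mp u.isUnit
  have h2 := Algebra.norm_eq_prod_embeddings ℚ ℂ ((u : 𝓞 K) : K)
  have h3 : (1 : ℝ) = ∏ φ : K →ₐ[ℚ] ℂ, ‖φ ((u : 𝓞 K) : K)‖ := by
    rw [← norm_prod, ← h2, eq_ratCast, Complex.norm_ratCast]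
    exact_mod_cast h1.symm
  refine h3.not_lt ?_
  calc (1 : ℝ) = ∏ _φ : K →ₐ[ℚ] ℂ, (1 : ℝ) := by simp
    _ < _ := Finset.prod_lt_prod_of_nonempty (fun _ _ => one_pos)
      (fun φ _ => hz φ.toRingHom) ⟨w.toRatAlgHom, Finset.mem_univ _⟩

/-- A sufficiently large multiple of a given positive integer moves every complex conjugate of
`x` outside the unit disc. -/
lemma exists_nat_one_lt_norm_add {K : Type*} [Field K] [NumberField K] (x : K) {d : ℕ}
    (hd : d ≠ 0) : ∃ s : ℕ, ∀ φ : K →+* ℂ, 1 < ‖φ (x + d * s)‖ := by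
  obtain ⟨s, hs⟩ := exists_nat_gt (1 + ∑ φ : K →+* ℂ, ‖φ x‖)
  refine ⟨s, fun φ => ?_⟩
  have h1 : ‖φ x‖ ≤ ∑ φ : K →+* ℂ, ‖φ x‖ :=
    Finset.single_le_sum (f := fun φ : K →+* ℂ => ‖φ x‖) (fun _ _ => norm_nonneg _)
      (Finset.mem_univ φ)
  have h2 : (s : ℝ) ≤ d * s :=
    le_mul_of_one_le_left s.cast_nonneg (by exact_mod_cast Nat.one_le_iff_ne_zero.mpr hd)
  have h3 : ‖φ (d * s)‖ = d * s := by simp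
  have h4 := norm_sub_le (φ (x + d * s)) (φ x)
  rw [← map_sub, add_sub_cancel_left, h3] at h4
  linarith

/-- A finite extension of number fields has an integral primitive element. -/
lemma exists_integral_primitive_element (K₀ K : Type*) [Field K₀] [NumberField K₀] [Field K]
    [NumberField K] [Algebra K₀ K] [FiniteDimensional K₀ K] :
    ∃ α : 𝓞 K, IntermediateField.adjoin K₀ {(α : K)} = ⊤ := by
  obtain ⟨θ, hθ⟩ := Field.exists_primitive_element K₀ K
  have halg : IsAlgebraic ℤ θ := (IsFractionRing.isAlgebraic_iff ℤ ℚ K).mpr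
    (Algebra.IsAlgebraic.isAlgebraic θ)
  obtain ⟨y, hy, hint⟩ := halg.exists_integral_multiple
  refine ⟨⟨y • θ, hint⟩, top_unique (hθ ▸ ?_)⟩
  rw [IntermediateField.adjoin_simple_le_iff]
  have hmem : y • θ ∈ IntermediateField.adjoin K₀ {y • θ} :=
    IntermediateField.mem_adjoin_simple_self K₀ _
  have hy' : (y : K) ≠ 0 := by exact_mod_cast hy
  have h := mul_mem (inv_mem (intCast_mem (IntermediateField.adjoin K₀ {y • θ}) y)) hmem
  rwa [zsmul_eq_mul, inv_mul_cancel_left₀ hy', ← zsmul_eq_mul] at h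

/-- An element with pairwise distinct conjugates generates a Galois extension. -/
lemma adjoin_simple_eq_top_of_forall_fixed {F E : Type*} [Field F] [Field E] [Algebra F E]
    [FiniteDimensional F E] [IsGalois F E] {z : E} (h : ∀ σ : E ≃ₐ[F] E, σ z = z → σ = 1) :
    IntermediateField.adjoin F {z} = ⊤ := by
  rw [← IsGalois.fixedField_fixingSubgroup (IntermediateField.adjoin F {z})]
  have : (IntermediateField.adjoin F {z}).fixingSubgroup = ⊥ := by
    refine (Subgroup.eq_bot_iff_forall _).mpr fun σ hσ => h σ ?_
    exact (IntermediateField.mem_fixingSubgroup_iff _ _).mp hσ z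
      (IntermediateField.mem_adjoin_simple_self F z)
  rw [this, IntermediateField.fixedField_bot]

/-- If `x - y` divides `d`, then `1 + d * x` and `1 + d * y` are coprime. -/
lemma isCoprime_one_add_mul {R : Type*} [CommRing R] {d x y : R} (h : x - y ∣ d) :
    IsCoprime (1 + d * x) (1 + d * y) := by
  obtain ⟨c, rfl⟩ := h
  exact ⟨1 - (x - y) * c * x + x ^ 2 * c, -(x ^ 2 * c), by ring⟩

/-- Lemma 6.4 of Fehm–Paran: let `K/K₀` be a finite Galois extension of
number fields, `R = 𝒪_K`, and `0 ≠ b ∈ R`. Then there is a nonzero non-invertible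
`z ∈ R` which is a primitive element of `K/K₀`, whose conjugates under `Gal(K/K₀)` are
pairwise coprime in `R`, and each of whose conjugates is coprime to `b`. -/
theorem stmt_18 (K₀ : Type*) [Field K₀] [NumberField K₀]
    (K : Type*) [Field K] [NumberField K] [Algebra K₀ K]
    [FiniteDimensional K₀ K] [IsGalois K₀ K]
    (b : 𝓞 K) (hb : b ≠ 0) :
    ∃ z : 𝓞 K, z ≠ 0 ∧ ¬IsUnit z ∧
      IntermediateField.adjoin K₀ {(z : K)} = ⊤ ∧
      (∀ σ τ : K ≃ₐ[K₀] K, σ ≠ τ → ∀ zσ zτ : 𝓞 K,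
        (zσ : K) = σ (z : K) → (zτ : K) = τ (z : K) → IsCoprime zσ zτ) ∧
      (∀ σ : K ≃ₐ[K₀] K, ∀ zσ : 𝓞 K, (zσ : K) = σ (z : K) → IsCoprime zσ b) := by
  obtain ⟨α, hα⟩ := exists_integral_primitive_element K₀ K
  have hinj : ∀ σ τ : K ≃ₐ[K₀] K, σ (α : K) = τ (α : K) → σ = τ := fun σ τ h =>
    AlgEquiv.coe_toAlgHom_injective
      (AlgHom.ext_of_adjoin_eq_top (IntermediateField.adjoin_eq_top_iff.mp hα)
        (Set.eqOn_singleton.mpr h))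
  choose a ha using fun σ : K ≃ₐ[K₀] K =>
    (⟨⟨σ α, α.isIntegral_coe.map (σ.toAlgHom.restrictScalars ℤ)⟩, rfl⟩ :
      ∃ x : 𝓞 K, (x : K) = σ (α : K))
  classical
  let P : Finset ((K ≃ₐ[K₀] K) × (K ≃ₐ[K₀] K)) := {p | p.1 ≠ p.2}
  have he : b * ∏ p ∈ P, (a p.1 - a p.2) ≠ 0 := by
    refine mul_ne_zero hb (Finset.prod_ne_zero_iff.mpr fun p hp => sub_ne_zero.mpr fun h => ?_)
    refine (Finset.mem_filter.mp hp).2 (hinj _ _ ?_)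
    rw [← ha, ← ha, h]
  obtain ⟨d, hd, hed⟩ := exists_natCast_dvd he
  obtain ⟨s, hs⟩ := exists_nat_one_lt_norm_add (1 + d * (α : K)) hd
  have hz : ((1 + d * (α + s) : 𝓞 K) : K) = 1 + d * (α : K) + d * s := by
    push_cast
    ring
  have hconj : ∀ (σ : K ≃ₐ[K₀] K) (x : 𝓞 K), (x : K) = σ ((1 + d * (α + s) : 𝓞 K) : K) →
      x = 1 + d * (a σ + s) := fun σ x hx => by
    apply RingOfIntegers.ext
    rw [hx, hz]
    simp only [map_add, map_mul, map_one, map_natCast, ha]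
    ring
  have hunit : ¬IsUnit (1 + d * (α + s) : 𝓞 K) :=
    not_isUnit_of_one_lt_norm_embeddings fun φ => hz ▸ hs φ
  refine ⟨1 + d * (α + s), fun h0 => ?_, hunit, ?_, ?_, ?_⟩
  · obtain ⟨φ⟩ : Nonempty (K →+* ℂ) := inferInstance
    have := hs φ
    rw [← hz, h0] at this
    simp at this
    linarith
  · refine adjoin_simple_eq_top_of_forall_fixed fun σ hσ => hinj σ 1 ?_
    have hd' : (d : K) ≠ 0 := by exact_mod_cast hd
    rw [hz] at hσ
    simpa [hd'] using hσ
  · intro σ τ hστ zσ zτ hσ hτ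
    rw [hconj σ zσ hσ, hconj τ zτ hτ]
    refine isCoprime_one_add_mul (Dvd.dvd.trans ?_ ((dvd_mul_left _ b).trans hed))
    rw [add_sub_add_right_eq_sub]
    exact Finset.dvd_prod_of_mem (fun p : (K ≃ₐ[K₀] K) × (K ≃ₐ[K₀] K) => a p.1 - a p.2)
      (a := (σ, τ)) (Finset.mem_filter.mpr ⟨Finset.mem_univ _, hστ⟩)
  · intro σ zσ hσ
    rw [hconj σ zσ hσ]
    obtain ⟨c, hc⟩ := (dvd_mul_right b _).trans hed
    exact ⟨1, -(c * (a σ + s)), by rw [hc]; ring⟩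
end
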